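/- Let $n \geq 2$ and $k \geq \ell \geq \ell' \geq t \geq 1$. If $\mathcal{F} \subseteq \mathcal{H}(n,k,\ell)$ and $\mathcal{G} \subseteq \mathcal{H}(n,k,\ell')$ are non-empty cross $t$-intersecting separated families, then $|\mathcal{F}| + |\mathcal{G}| \leq \max\big\{|\mathcal{F}_0| + |\mathcal{G}_0|,\ \max_{a \in [\ell'+1, \ell]} \{|\mathcal{F}_a| + |\mathcal{G}_a|\}\big\}$. -/

import Mathlib

open Classical

/-- The `i`-th block `X_i` of size `n`: `X_i = ((i-1)n, i n]`. -/
def Xblock (n i : ℕ) : Finset ℕ := Finset.Ioc ((i - 1) * n) (i * n)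

/-- The minimum element `v_i` of block `X_i`. -/
def vmin (n i : ℕ) : ℕ := (i - 1) * n + 1

/-- The set `{v_1, …, v_a}` of minimum elements of the first `a` blocks. -/
def Vset (n a : ℕ) : Finset ℕ := (Finset.Icc 1 a).image (vmin n)

/-- The separated families `H(n, k, l)`. -/
noncomputable def Hfam (n k l : ℕ) : Finset (Finset ℕ) :=
  (Finset.Icc 1 (n * k)).powerset.filter
    (fun S => S.card = l ∧ ∀ i ∈ Finset.Icc 1 k, (S ∩ Xblock n i).card ≤ 1)

/-- Replace `j` by `i` in `A` whenever `j ∈ A` and `i ∉ A`. -/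
def shiftSet (i j : ℕ) (A : Finset ℕ) : Finset ℕ :=
  if j ∈ A ∧ i ∉ A then insert i (A.erase j) else A

/-- The `(i, j)`-shift of a family of sets. -/
def shiftFamily (i j : ℕ) (F : Finset (Finset ℕ)) : Finset (Finset ℕ) :=
  F.image (fun A => if shiftSet i j A ∈ F then A else shiftSet i j A)

theorem mem_shiftSet_of_ne {i j x : ℕ} (A : Finset ℕ) (hi : x ≠ i) (hj : x ≠ j) :
    x ∈ shiftSet i j A ↔ x ∈ A := by
  unfold shiftSet
  split_ifs <;> simp [hi, hj]

theorem left_mem_shiftSet {i j : ℕ} (A : Finset ℕ) :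
    i ∈ shiftSet i j A ↔ i ∈ A ∨ j ∈ A := by
  unfold shiftSet
  split_ifs with h
  · simp [h.1]
  · tauto

theorem right_mem_shiftSet {i j : ℕ} (hij : i ≠ j) (A : Finset ℕ) :
    j ∈ shiftSet i j A ↔ j ∈ A ∧ i ∈ A := by
  unfold shiftSet
  split_ifs with h
  · simp [h.2, hij.symm]
  · tauto

theorem shiftSet_eq_of_moved {i j : ℕ} {A : Finset ℕ} (h : shiftSet i j A ≠ A) :
    j ∈ A ∧ i ∉ A := by
  by_contra hc
  exact h (if_neg hc)

theorem shiftSet_injOn_moved {i j : ℕ} (hij : i ≠ j) {A B : Finset ℕ}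
    (hA : j ∈ A ∧ i ∉ A) (hB : j ∈ B ∧ i ∉ B) (h : shiftSet i j A = shiftSet i j B) : A = B := by
  ext x
  by_cases hxi : x = i
  · subst hxi; simp [hA.2, hB.2]
  by_cases hxj : x = j
  · subst hxj; simp [hA.1, hB.1]
  rw [← mem_shiftSet_of_ne A hxi hxj, h, mem_shiftSet_of_ne B hxi hxj]

theorem shift_choice_injOn {i j : ℕ} (hij : i ≠ j) (F : Finset (Finset ℕ)) :
    Set.InjOn (fun A => if shiftSet i j A ∈ F then A else shiftSet i j A) (F : Set (Finset ℕ)) := by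
  intro A hA B hB h
  simp only [Finset.mem_coe] at hA hB
  simp only at h
  split_ifs at h with h1 h2 h2
  · exact h
  · rw [h] at hA; exact absurd hA h2
  · rw [← h] at hB; exact absurd hB h1
  · refine shiftSet_injOn_moved hij (shiftSet_eq_of_moved ?_) (shiftSet_eq_of_moved ?_) h
    · intro hc; rw [hc] at h1; exact h1 hA
    · intro hc; rw [hc] at h2; exact h2 hB

theorem card_inter_inter_eq {i j : ℕ} (hij : i ≠ j) {T : Finset ℕ} (hi : i ∈ T) (hj : j ∈ T)
    (A B : Finset ℕ) :
    (A ∩ B ∩ T).card = (A ∩ B ∩ ((T.erase i).erase j)).card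
      + (if i ∈ A ∧ i ∈ B then 1 else 0) + (if j ∈ A ∧ j ∈ B then 1 else 0) := by
  have key : ∀ (a : ℕ) (S C : Finset ℕ), a ∈ S →
      (C ∩ S).card = (C ∩ S.erase a).card + if a ∈ C then 1 else 0 := by
    intro a S C ha
    rw [Finset.inter_erase]
    split_ifs with hc
    · exact (Finset.card_erase_add_one (Finset.mem_inter.2 ⟨hc, ha⟩)).symm
    · rw [Finset.erase_eq_of_notMem (by simp [hc])]; rfl
  rw [key i T _ hi, key j (T.erase i) _ (by simp [hj, hij.symm])]
  simp only [Finset.mem_inter]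
  omega

theorem card_inter_le_shiftSet {i j t : ℕ} (hij : i ≠ j) {T : Finset ℕ} (hi : i ∈ T) (hj : j ∈ T)
    {A B : Finset ℕ} (h : t ≤ (A ∩ B ∩ T).card) (h' : t ≤ (A ∩ shiftSet i j B ∩ T).card) :
    t ≤ (shiftSet i j A ∩ B ∩ T).card := by
  have e1 : A ∩ shiftSet i j B ∩ ((T.erase i).erase j) = A ∩ B ∩ ((T.erase i).erase j) := by
    ext x
    simp only [Finset.mem_inter, Finset.mem_erase]
    constructor
    · rintro ⟨⟨h1, h2⟩, h3, h4, h5⟩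
      exact ⟨⟨h1, (mem_shiftSet_of_ne B h4 h3).1 h2⟩, h3, h4, h5⟩
    · rintro ⟨⟨h1, h2⟩, h3, h4, h5⟩
      exact ⟨⟨h1, (mem_shiftSet_of_ne B h4 h3).2 h2⟩, h3, h4, h5⟩
  have e2 : shiftSet i j A ∩ B ∩ ((T.erase i).erase j) = A ∩ B ∩ ((T.erase i).erase j) := by
    ext x
    simp only [Finset.mem_inter, Finset.mem_erase]
    constructor
    · rintro ⟨⟨h1, h2⟩, h3, h4, h5⟩
      exact ⟨⟨(mem_shiftSet_of_ne A h4 h3).1 h1, h2⟩, h3, h4, h5⟩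
    · rintro ⟨⟨h1, h2⟩, h3, h4, h5⟩
      exact ⟨⟨(mem_shiftSet_of_ne A h4 h3).2 h1, h2⟩, h3, h4, h5⟩
  rw [card_inter_inter_eq hij hi hj] at h h' ⊢
  rw [e1] at h'
  rw [e2]
  simp only [left_mem_shiftSet, right_mem_shiftSet hij] at h h' ⊢
  by_cases a1 : i ∈ A <;> by_cases a2 : j ∈ A <;> by_cases b1 : i ∈ B <;> by_cases b2 : j ∈ B <;>
    (simp_all; try omega)

theorem card_inter_le_shiftSet_shiftSet {i j t : ℕ} (hij : i ≠ j) {T : Finset ℕ} (hi : i ∈ T)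
    (hj : j ∈ T) {A B : Finset ℕ} (h : t ≤ (A ∩ B ∩ T).card) (hA : j ∈ A ∧ i ∉ A)
    (hB : j ∈ B ∧ i ∉ B) : t ≤ (shiftSet i j A ∩ shiftSet i j B ∩ T).card := by
  have e : shiftSet i j A ∩ shiftSet i j B ∩ ((T.erase i).erase j)
      = A ∩ B ∩ ((T.erase i).erase j) := by
    ext x
    simp only [Finset.mem_inter, Finset.mem_erase]
    constructor
    · rintro ⟨⟨h1, h2⟩, h3, h4, h5⟩
      exact ⟨⟨(mem_shiftSet_of_ne A h4 h3).1 h1, (mem_shiftSet_of_ne B h4 h3).1 h2⟩, h3, h4, h5⟩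
    · rintro ⟨⟨h1, h2⟩, h3, h4, h5⟩
      exact ⟨⟨(mem_shiftSet_of_ne A h4 h3).2 h1, (mem_shiftSet_of_ne B h4 h3).2 h2⟩, h3, h4, h5⟩
  rw [card_inter_inter_eq hij hi hj] at h ⊢
  rw [e]
  simp only [left_mem_shiftSet, right_mem_shiftSet hij] at h ⊢
  simp_all

/-- Every member of `F` meets every member of `G` in at least `t` points of `T`. -/
def CrossOn (t : ℕ) (T : Finset ℕ) (F G : Finset (Finset ℕ)) : Prop :=
  ∀ A ∈ F, ∀ B ∈ G, t ≤ (A ∩ B ∩ T).card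

theorem CrossOn.symm {t : ℕ} {T : Finset ℕ} {F G : Finset (Finset ℕ)} (h : CrossOn t T F G) :
    CrossOn t T G F := fun B hB A hA => by
  rw [Finset.inter_comm B A]; exact h A hA B hB

theorem CrossOn.shiftFamily {i j t : ℕ} (hij : i ≠ j) {T : Finset ℕ} (hi : i ∈ T) (hj : j ∈ T)
    {F G : Finset (Finset ℕ)} (h : CrossOn t T F G) :
    CrossOn t T (shiftFamily i j F) (shiftFamily i j G) := by
  intro A' hA' B' hB'
  obtain ⟨A, hA, rfl⟩ := Finset.mem_image.1 hA'
  obtain ⟨B, hB, rfl⟩ := Finset.mem_image.1 hB'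
  split_ifs with h1 h2 h2
  · exact h A hA B hB
  · rw [Finset.inter_comm A]
    exact card_inter_le_shiftSet hij hi hj (h.symm B hB A hA) (h.symm B hB _ h1)
  · exact card_inter_le_shiftSet hij hi hj (h A hA B hB) (h A hA _ h2)
  · refine card_inter_le_shiftSet_shiftSet hij hi hj (h A hA B hB) (shiftSet_eq_of_moved ?_)
      (shiftSet_eq_of_moved ?_)
    · intro hc; rw [hc] at h1; exact h1 hA
    · intro hc; rw [hc] at h2; exact h2 hB

theorem sum_le_sum_shiftFamily {i j : ℕ} (hij : i ≠ j) (F : Finset (Finset ℕ))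
    (w : Finset ℕ → ℕ) (hw : ∀ A ∈ F, w A ≤ w (shiftSet i j A)) :
    ∑ A ∈ F, w A ≤ ∑ A ∈ shiftFamily i j F, w A := by
  rw [shiftFamily, Finset.sum_image (shift_choice_injOn hij F)]
  refine Finset.sum_le_sum fun A hA => ?_
  split_ifs
  · exact le_rfl
  · exact hw A hA

theorem sum_id_shiftSet_lt {i j : ℕ} (hij : i < j) {A : Finset ℕ} (hA : j ∈ A ∧ i ∉ A) :
    ∑ x ∈ shiftSet i j A, x < ∑ x ∈ A, x := by
  rw [shiftSet, if_pos hA, Finset.sum_insert (by simp [hA.2])]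
  have := Finset.add_sum_erase A (fun x => x) hA.1
  omega

theorem sum_id_shiftSet_le {i j : ℕ} (hij : i < j) (A : Finset ℕ) :
    ∑ x ∈ shiftSet i j A, x ≤ ∑ x ∈ A, x := by
  by_cases hA : j ∈ A ∧ i ∉ A
  · exact (sum_id_shiftSet_lt hij hA).le
  · rw [shiftSet, if_neg hA]

/-- The sum of all elements of all members of `F`. -/
def totalSum (F : Finset (Finset ℕ)) : ℕ := ∑ A ∈ F, ∑ x ∈ A, x

theorem totalSum_shiftFamily_le {i j : ℕ} (hij : i < j) (F : Finset (Finset ℕ)) :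
    totalSum (shiftFamily i j F) ≤ totalSum F := by
  rw [totalSum, shiftFamily, Finset.sum_image (shift_choice_injOn hij.ne F)]
  refine Finset.sum_le_sum fun A _ => ?_
  split_ifs
  · exact le_rfl
  · exact sum_id_shiftSet_le hij A

theorem totalSum_shiftFamily_lt {i j : ℕ} (hij : i < j) {F : Finset (Finset ℕ)} {A : Finset ℕ}
    (hA : A ∈ F) (hs : shiftSet i j A ∉ F) : totalSum (shiftFamily i j F) < totalSum F := by
  rw [totalSum, shiftFamily, Finset.sum_image (shift_choice_injOn hij.ne F)]
  refine Finset.sum_lt_sum (fun B _ => ?_) ⟨A, hA, ?_⟩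
  · split_ifs
    · exact le_rfl
    · exact sum_id_shiftSet_le hij B
  · rw [if_neg hs]
    refine sum_id_shiftSet_lt hij (shiftSet_eq_of_moved fun hc => ?_)
    rw [hc] at hs
    exact hs hA

theorem shiftFamily_subset {i j : ℕ} {F U : Finset (Finset ℕ)} (hF : F ⊆ U)
    (hU : ∀ A ∈ U, shiftSet i j A ∈ U) : shiftFamily i j F ⊆ U := by
  intro A' hA'
  obtain ⟨A, hA, rfl⟩ := Finset.mem_image.1 hA'
  split_ifs
  · exact hF hA
  · exact hU A (hF hA)

/-- Repeated shifting makes cross intersecting families stable under a set `R` of downward shifts,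
without decreasing their weights. -/
theorem exists_stable (R : ℕ → ℕ → Prop) (t : ℕ) (T : Finset ℕ) (U₁ U₂ : Finset (Finset ℕ))
    (w₁ w₂ : Finset ℕ → ℕ) (hlt : ∀ i j, R i j → i < j)
    (hT : ∀ i j, R i j → i ∈ T ∧ j ∈ T)
    (hU₁ : ∀ i j, R i j → ∀ A ∈ U₁, shiftSet i j A ∈ U₁)
    (hU₂ : ∀ i j, R i j → ∀ A ∈ U₂, shiftSet i j A ∈ U₂)
    (hw₁ : ∀ i j, R i j → ∀ A ∈ U₁, w₁ A ≤ w₁ (shiftSet i j A))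
    (hw₂ : ∀ i j, R i j → ∀ A ∈ U₂, w₂ A ≤ w₂ (shiftSet i j A))
    (F G : Finset (Finset ℕ)) (hF : F ⊆ U₁) (hG : G ⊆ U₂) (hFn : F.Nonempty) (hGn : G.Nonempty)
    (hc : CrossOn t T F G) :
    ∃ F' G' : Finset (Finset ℕ), F' ⊆ U₁ ∧ G' ⊆ U₂ ∧ F'.Nonempty ∧ G'.Nonempty ∧
      CrossOn t T F' G' ∧ ∑ A ∈ F, w₁ A ≤ ∑ A ∈ F', w₁ A ∧ ∑ A ∈ G, w₂ A ≤ ∑ A ∈ G', w₂ A ∧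
      (∀ i j, R i j → ∀ A ∈ F', shiftSet i j A ∈ F') ∧
      (∀ i j, R i j → ∀ A ∈ G', shiftSet i j A ∈ G') := by
  induction hN : totalSum F + totalSum G using Nat.strong_induction_on generalizing F G with
  | _ N ih =>
    by_cases hst : (∀ i j, R i j → ∀ A ∈ F, shiftSet i j A ∈ F) ∧
        (∀ i j, R i j → ∀ A ∈ G, shiftSet i j A ∈ G)
    · exact ⟨F, G, hF, hG, hFn, hGn, hc, le_rfl, le_rfl, hst.1, hst.2⟩
    have hR : ∃ i j, R i j ∧
        totalSum (shiftFamily i j F) + totalSum (shiftFamily i j G) < N := by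
      rw [not_and_or] at hst
      push Not at hst
      rcases hst with ⟨i, j, hij, A, hA, hs⟩ | ⟨i, j, hij, A, hA, hs⟩
      · have h1 := totalSum_shiftFamily_lt (hlt i j hij) hA hs
        have h2 := totalSum_shiftFamily_le (hlt i j hij) G
        exact ⟨i, j, hij, by omega⟩
      · have h1 := totalSum_shiftFamily_lt (hlt i j hij) hA hs
        have h2 := totalSum_shiftFamily_le (hlt i j hij) F
        exact ⟨i, j, hij, by omega⟩
    obtain ⟨i, j, hij, hlt'⟩ := hR
    have hne := (hlt i j hij).ne
    obtain ⟨F', G', a1, a2, a3, a4, a5, a6, a7, a8⟩ := ih _ hlt' (shiftFamily i j F)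
      (shiftFamily i j G) (shiftFamily_subset hF (hU₁ i j hij))
      (shiftFamily_subset hG (hU₂ i j hij)) (hFn.image _) (hGn.image _)
      (hc.shiftFamily hne (hT i j hij).1 (hT i j hij).2) rfl
    exact ⟨F', G', a1, a2, a3, a4, a5,
      (sum_le_sum_shiftFamily hne F w₁ fun A hA => hw₁ i j hij A (hF hA)).trans a6,
      (sum_le_sum_shiftFamily hne G w₂ fun A hA => hw₂ i j hij A (hG hA)).trans a7, a8⟩

/-- A weight on the subsets of `{1, …, k}` that does not drop when an element is removed or
exchanged for another one. -/
structure IsMonotoneWeight (k : ℕ) (w : Finset ℕ → ℕ) : Prop where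
  le_erase : ∀ S ⊆ Finset.Icc 1 k, ∀ a ∈ S, w S ≤ w (S.erase a)
  le_shift : ∀ S ⊆ Finset.Icc 1 k, ∀ i ∈ Finset.Icc 1 k, ∀ j ∈ Finset.Icc 1 k,
    w S ≤ w (shiftSet i j S)

/-- The subsets of `{1, …, k}` with at most `l` elements. -/
def smallSets (k l : ℕ) : Finset (Finset ℕ) :=
  (Finset.Icc 1 k).powerset.filter (fun S => S.card ≤ l)

/-- The weight of all subsets of `{1, …, k}` containing `{1, …, a}`. -/
def coverSum (k : ℕ) (w : Finset ℕ → ℕ) (a : ℕ) : ℕ :=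
  ∑ S ∈ (Finset.Icc 1 k).powerset.filter (fun S => Finset.Icc 1 a ⊆ S), w S

/-- The weight of all subsets of `{1, …, k}` meeting `{1, …, a}` in at least `t` points. -/
def meetSum (k t : ℕ) (w : Finset ℕ → ℕ) (a : ℕ) : ℕ :=
  ∑ S ∈ (Finset.Icc 1 k).powerset.filter (fun S => t ≤ (S ∩ Finset.Icc 1 a).card), w S

theorem card_shiftSet (i j : ℕ) (A : Finset ℕ) : (shiftSet i j A).card = A.card := by
  unfold shiftSet
  split_ifs with h
  · rw [Finset.card_insert_of_notMem (by simp [h.2]), Finset.card_erase_add_one h.1]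
  · rfl

theorem shiftSet_subset {i j : ℕ} {A T : Finset ℕ} (hi : i ∈ T) (hA : A ⊆ T) :
    shiftSet i j A ⊆ T := by
  unfold shiftSet
  split_ifs with h
  · exact Finset.insert_subset hi ((Finset.erase_subset _ _).trans hA)
  · exact hA

theorem shiftSet_mem_smallSets {k l i j : ℕ} (hi : i ∈ Finset.Icc 1 k) {A : Finset ℕ}
    (hA : A ∈ smallSets k l) : shiftSet i j A ∈ smallSets k l := by
  simp only [smallSets, Finset.mem_filter, Finset.mem_powerset] at hA ⊢
  exact ⟨shiftSet_subset hi hA.1, by rw [card_shiftSet]; exact hA.2⟩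

theorem erase_mem_smallSets {k l a : ℕ} {A : Finset ℕ}
    (hA : A ∈ smallSets k l) : A.erase a ∈ smallSets k l := by
  simp only [smallSets, Finset.mem_filter, Finset.mem_powerset] at hA ⊢
  exact ⟨(Finset.erase_subset _ _).trans hA.1, (Finset.card_erase_le).trans hA.2⟩

theorem weight_le_of_cover {k l₁ l₂ t b M : ℕ} {w₁ w₂ : Finset ℕ → ℕ} {F G : Finset (Finset ℕ)}
    (hM : b ≤ l₁ → coverSum k w₁ b + meetSum k t w₂ b ≤ M)
    (hF : F ⊆ smallSets k l₁) (hG : G ⊆ smallSets k l₂) (hFn : F.Nonempty)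
    (hcov : ∀ A ∈ F, Finset.Icc 1 b ⊆ A) (hc : CrossOn t (Finset.Icc 1 b) F G) :
    ∑ A ∈ F, w₁ A + ∑ B ∈ G, w₂ B ≤ M := by
  obtain ⟨A₀, hA₀⟩ := hFn
  have hb : b ≤ l₁ := by
    have h1 := Finset.card_le_card (hcov A₀ hA₀)
    have h2 := (Finset.mem_filter.1 (hF hA₀)).2
    simp only [Nat.card_Icc] at h1
    omega
  refine le_trans (add_le_add (Finset.sum_le_sum_of_subset fun A hA => ?_)
    (Finset.sum_le_sum_of_subset fun B hB => ?_)) (hM hb)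
  · exact Finset.mem_filter.2 ⟨(Finset.mem_filter.1 (hF hA)).1, hcov A hA⟩
  · refine Finset.mem_filter.2 ⟨(Finset.mem_filter.1 (hG hB)).1, ?_⟩
    refine (hc A₀ hA₀ B hB).trans (Finset.card_le_card fun x hx => ?_)
    simp only [Finset.mem_inter] at hx ⊢
    tauto

/-- The members of `F` that fail to meet some member of `G` in `t` points of `T`. -/
def criticalSets (t : ℕ) (T : Finset ℕ) (F G : Finset (Finset ℕ)) : Finset (Finset ℕ) :=
  {A ∈ F | ∃ B ∈ G, (A ∩ B ∩ T).card < t}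

theorem criticalSets_subset (t : ℕ) (T : Finset ℕ) (F G : Finset (Finset ℕ)) :
    criticalSets t T F G ⊆ F :=
  Finset.filter_subset _ _

theorem inter_Icc_succ_of_notMem {a : ℕ} {C : Finset ℕ} (h : a + 1 ∉ C) :
    C ∩ Finset.Icc 1 (a + 1) = C ∩ Finset.Icc 1 a := by
  ext x
  simp only [Finset.mem_inter, Finset.mem_Icc]
  constructor
  · rintro ⟨h1, h2, h3⟩
    have : x ≠ a + 1 := fun hx => h (hx ▸ h1)
    exact ⟨h1, h2, by omega⟩
  · rintro ⟨h1, h2, h3⟩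
    exact ⟨h1, h2, by omega⟩

theorem mem_of_mem_criticalSets {t a : ℕ} {F G : Finset (Finset ℕ)}
    (hc : CrossOn t (Finset.Icc 1 (a + 1)) F G) {A : Finset ℕ}
    (hA : A ∈ criticalSets t (Finset.Icc 1 a) F G) : a + 1 ∈ A := by
  obtain ⟨hA, B, hB, hlt⟩ := Finset.mem_filter.1 hA
  by_contra hn
  have := hc A hA B hB
  rw [inter_Icc_succ_of_notMem (by simp [hn])] at this
  omega

theorem inter_erase_succ_inter_Icc {a : ℕ} (A B : Finset ℕ) :
    A ∩ B.erase (a + 1) ∩ Finset.Icc 1 a = A ∩ B ∩ Finset.Icc 1 a := by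
  ext x
  simp only [Finset.mem_inter, Finset.mem_Icc, Finset.mem_erase]
  constructor
  · tauto
  · rintro ⟨⟨h1, h2⟩, h3, h4⟩
    exact ⟨⟨h1, by omega, h2⟩, h3, h4⟩

theorem crossOn_exchange {t a : ℕ} {F G : Finset (Finset ℕ)} :
    CrossOn t (Finset.Icc 1 a) (F \ criticalSets t (Finset.Icc 1 a) F G)
      (G ∪ (criticalSets t (Finset.Icc 1 a) G F).image (fun B => B.erase (a + 1))) := by
  intro A hA
  have key : ∀ B ∈ G, t ≤ (A ∩ B ∩ Finset.Icc 1 a).card := by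
    intro B hB
    obtain ⟨h1, h2⟩ := Finset.mem_sdiff.1 hA
    by_contra hlt
    exact h2 (Finset.mem_filter.2 ⟨h1, B, hB, not_le.1 hlt⟩)
  intro B hB
  rcases Finset.mem_union.1 hB with hB | hB
  · exact key B hB
  · obtain ⟨C, hC, rfl⟩ := Finset.mem_image.1 hB
    rw [inter_erase_succ_inter_Icc]
    exact key C (Finset.mem_filter.1 hC).1

theorem sum_exchange {k l t a : ℕ} {w : Finset ℕ → ℕ} (hw : IsMonotoneWeight k w)
    {F G : Finset (Finset ℕ)} (hG : G ⊆ smallSets k l)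
    (hc : CrossOn t (Finset.Icc 1 (a + 1)) F G) :
    ∑ B ∈ G, w B + ∑ B ∈ criticalSets t (Finset.Icc 1 a) G F, w B ≤
      ∑ B ∈ G ∪ (criticalSets t (Finset.Icc 1 a) G F).image (fun B => B.erase (a + 1)), w B := by
  have hmem : ∀ B ∈ criticalSets t (Finset.Icc 1 a) G F, a + 1 ∈ B :=
    fun B hB => mem_of_mem_criticalSets hc.symm hB
  rw [Finset.sum_union, Finset.sum_image]
  · refine add_le_add le_rfl (Finset.sum_le_sum fun B hB => ?_)
    refine hw.le_erase B ?_ _ (hmem B hB)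
    exact Finset.mem_powerset.1 (Finset.mem_filter.1 (hG (Finset.mem_filter.1 hB).1)).1
  · intro B hB C hC h
    simp only at h
    rw [← Finset.insert_erase (hmem B hB), h, Finset.insert_erase (hmem C hC)]
  · rw [Finset.disjoint_right]
    intro B' hB' hBG
    obtain ⟨B, hB, rfl⟩ := Finset.mem_image.1 hB'
    obtain ⟨-, A, hA, hlt⟩ := Finset.mem_filter.1 hB
    have := hc A hA _ hBG
    rw [inter_Icc_succ_of_notMem (by simp), inter_erase_succ_inter_Icc, Finset.inter_comm A] at this
    omega

theorem cover_of_forall_mem {a : ℕ} {F : Finset (Finset ℕ)}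
    (hst : ∀ i, 1 ≤ i → i < a + 1 → ∀ A ∈ F, shiftSet i (a + 1) A ∈ F)
    (hmem : ∀ A ∈ F, a + 1 ∈ A) : ∀ A ∈ F, Finset.Icc 1 (a + 1) ⊆ A := by
  intro A hA x hx
  rw [Finset.mem_Icc] at hx
  rcases hx.2.eq_or_lt with rfl | hlt
  · exact hmem A hA
  · exact ((right_mem_shiftSet hlt.ne A).1 (hmem _ (hst x hx.1 hlt A hA))).2

theorem weight_le_of_crossOn {k t M l₁ l₂ a : ℕ} {w₁ w₂ : Finset ℕ → ℕ}
    (hw₁ : IsMonotoneWeight k w₁) (hw₂ : IsMonotoneWeight k w₂)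
    (hM₁ : ∀ b, t ≤ b → b ≤ l₁ → coverSum k w₁ b + meetSum k t w₂ b ≤ M)
    (hM₂ : ∀ b, t ≤ b → b ≤ l₂ → coverSum k w₂ b + meetSum k t w₁ b ≤ M)
    (hta : t ≤ a) (hak : a ≤ k) (F G : Finset (Finset ℕ))
    (hF : F ⊆ smallSets k l₁) (hG : G ⊆ smallSets k l₂) (hFn : F.Nonempty) (hGn : G.Nonempty)
    (hc : CrossOn t (Finset.Icc 1 a) F G) :
    ∑ A ∈ F, w₁ A + ∑ B ∈ G, w₂ B ≤ M := by
  induction a, hta using Nat.le_induction generalizing F G with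
  | base =>
    refine weight_le_of_cover (hM₁ t le_rfl) hF hG hFn (fun A hA => ?_) hc
    obtain ⟨B, hB⟩ := hGn
    have h1 := hc A hA B hB
    have h2 : A ∩ B ∩ Finset.Icc 1 t = Finset.Icc 1 t :=
      Finset.eq_of_subset_of_card_le Finset.inter_subset_right (by simpa using h1)
    rw [← h2]
    exact Finset.inter_subset_left.trans Finset.inter_subset_left
  | succ a hta ih =>
    have hsub : Finset.Icc 1 (a + 1) ⊆ Finset.Icc 1 k := Finset.Icc_subset_Icc_right hak
    have hR : ∀ i j, 1 ≤ i ∧ i < j ∧ j = a + 1 →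
        i ∈ Finset.Icc 1 (a + 1) ∧ j ∈ Finset.Icc 1 (a + 1) := by
      intro i j h
      simp only [Finset.mem_Icc]
      omega
    have hpow : ∀ {l A}, A ∈ smallSets k l → A ⊆ Finset.Icc 1 k :=
      fun hA => Finset.mem_powerset.1 (Finset.mem_filter.1 hA).1
    obtain ⟨F', G', hF', hG', hFn', hGn', hc', hle₁, hle₂, hst₁, hst₂⟩ :=
      exists_stable (fun i j => 1 ≤ i ∧ i < j ∧ j = a + 1) t (Finset.Icc 1 (a + 1))
        (smallSets k l₁) (smallSets k l₂) w₁ w₂ (fun i j h => h.2.1) hR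
        (fun i j h A hA => shiftSet_mem_smallSets (hsub (hR i j h).1) hA)
        (fun i j h A hA => shiftSet_mem_smallSets (hsub (hR i j h).1) hA)
        (fun i j h A hA => hw₁.le_shift A (hpow hA) i (hsub (hR i j h).1) j (hsub (hR i j h).2))
        (fun i j h A hA => hw₂.le_shift A (hpow hA) i (hsub (hR i j h).1) j (hsub (hR i j h).2))
        F G hF hG hFn hGn hc
    refine (add_le_add hle₁ hle₂).trans ?_
    by_cases hFe : criticalSets t (Finset.Icc 1 a) F' G' = F'
    · refine weight_le_of_cover (hM₁ (a + 1) (by omega)) hF' hG' hFn' ?_ hc'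
      refine cover_of_forall_mem (fun i h1 h2 => hst₁ i _ ⟨h1, h2, rfl⟩) fun A hA => ?_
      exact mem_of_mem_criticalSets hc' (hFe.symm ▸ hA)
    by_cases hGe : criticalSets t (Finset.Icc 1 a) G' F' = G'
    · rw [add_comm]
      refine weight_le_of_cover (hM₂ (a + 1) (by omega)) hG' hF' hGn' ?_ hc'.symm
      refine cover_of_forall_mem (fun i h1 h2 => hst₂ i _ ⟨h1, h2, rfl⟩) fun A hA => ?_
      exact mem_of_mem_criticalSets hc'.symm (hGe.symm ▸ hA)
    have hne : ∀ {X Y : Finset (Finset ℕ)}, criticalSets t (Finset.Icc 1 a) X Y ≠ X →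
        (X \ criticalSets t (Finset.Icc 1 a) X Y).Nonempty := fun h =>
      Finset.sdiff_nonempty.2 fun hs => h ((criticalSets_subset _ _ _ _).antisymm hs)
    have himg : ∀ {l} {X Y : Finset (Finset ℕ)}, X ⊆ smallSets k l →
        X ∪ (criticalSets t (Finset.Icc 1 a) X Y).image (fun B => B.erase (a + 1)) ⊆
          smallSets k l := by
      intro l X Y hX
      refine Finset.union_subset hX fun B' hB' => ?_
      obtain ⟨B, hB, rfl⟩ := Finset.mem_image.1 hB'
      exact erase_mem_smallSets (hX (Finset.mem_filter.1 hB).1)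
    have hsF := Finset.sum_sdiff (f := w₁) (criticalSets_subset t (Finset.Icc 1 a) F' G')
    have hsG := Finset.sum_sdiff (f := w₂) (criticalSets_subset t (Finset.Icc 1 a) G' F')
    rcases le_total (∑ A ∈ criticalSets t (Finset.Icc 1 a) F' G', w₁ A)
      (∑ B ∈ criticalSets t (Finset.Icc 1 a) G' F', w₂ B) with hle | hle
    · have h1 := ih (by omega) _ _ (Finset.sdiff_subset.trans hF') (himg hG') (hne hFe)
        (hGn'.mono Finset.subset_union_left) crossOn_exchange
      have h2 := sum_exchange hw₂ hG' hc'
      omega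
    · have h1 := ih (by omega) _ _ (himg hF') (Finset.sdiff_subset.trans hG')
        (hFn'.mono Finset.subset_union_left) (hne hGe) crossOn_exchange.symm
      have h2 := sum_exchange hw₁ hF' hc'.symm
      omega

theorem sum_le_sum_of_injOn_le {w : Finset ℕ → ℕ} {X Y : Finset (Finset ℕ)}
    (φ : Finset ℕ → Finset ℕ) (hmaps : ∀ S ∈ X, φ S ∈ Y)
    (hinj : ∀ S ∈ X, ∀ S' ∈ X, φ S = φ S' → S = S') (hw : ∀ S ∈ X, w S ≤ w (φ S)) :
    ∑ S ∈ X, w S ≤ ∑ S ∈ Y, w S := by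
  calc ∑ S ∈ X, w S ≤ ∑ S ∈ X, w (φ S) := Finset.sum_le_sum hw
    _ = ∑ S ∈ X.image φ, w S := (Finset.sum_image fun S hS S' hS' h => hinj S hS S' hS' h).symm
    _ ≤ ∑ S ∈ Y, w S := Finset.sum_le_sum_of_subset (Finset.image_subset_iff.2 hmaps)

/-- The subsets of `{1, …, k}` containing `{1, …, a}` but not `a + 1`. -/
def coverGap (k a : ℕ) : Finset (Finset ℕ) :=
  (Finset.Icc 1 k).powerset.filter (fun S => Finset.Icc 1 a ⊆ S ∧ a + 1 ∉ S)

/-- The subsets of `{1, …, k}` whose `t`-th element is `a + 1`. -/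
def meetGap (k t a : ℕ) : Finset (Finset ℕ) :=
  (Finset.Icc 1 k).powerset.filter (fun S => (S ∩ Finset.Icc 1 a).card + 1 = t ∧ a + 1 ∈ S)

theorem mem_coverGap {k a : ℕ} {S : Finset ℕ} :
    S ∈ coverGap k a ↔ S ⊆ Finset.Icc 1 k ∧ Finset.Icc 1 a ⊆ S ∧ a + 1 ∉ S := by
  simp [coverGap]

theorem mem_meetGap {k t a : ℕ} {S : Finset ℕ} :
    S ∈ meetGap k t a ↔
      S ⊆ Finset.Icc 1 k ∧ (S ∩ Finset.Icc 1 a).card + 1 = t ∧ a + 1 ∈ S := by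
  simp [meetGap]

theorem Icc_succ_subset_iff {a : ℕ} {S : Finset ℕ} :
    Finset.Icc 1 (a + 1) ⊆ S ↔ Finset.Icc 1 a ⊆ S ∧ a + 1 ∈ S := by
  constructor
  · intro h
    exact ⟨(Finset.Icc_subset_Icc_right (by omega)).trans h, h (by simp)⟩
  · rintro ⟨h1, h2⟩ x hx
    rw [Finset.mem_Icc] at hx
    rcases hx.2.eq_or_lt with rfl | hlt
    · exact h2
    · exact h1 (Finset.mem_Icc.2 ⟨hx.1, by omega⟩)

theorem card_inter_Icc_succ_of_mem {a : ℕ} {S : Finset ℕ} (h : a + 1 ∈ S) :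
    (S ∩ Finset.Icc 1 (a + 1)).card = (S ∩ Finset.Icc 1 a).card + 1 := by
  have : S ∩ Finset.Icc 1 (a + 1) = insert (a + 1) (S ∩ Finset.Icc 1 a) := by
    ext x
    simp only [Finset.mem_inter, Finset.mem_Icc, Finset.mem_insert]
    constructor
    · rintro ⟨h1, h2, h3⟩
      rcases h3.eq_or_lt with h4 | h4
      · exact Or.inl h4
      · exact Or.inr ⟨h1, h2, by omega⟩
    · rintro (rfl | ⟨h1, h2, h3⟩)
      · exact ⟨h, by omega, le_rfl⟩
      · exact ⟨h1, h2, by omega⟩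
  rw [this, Finset.card_insert_of_notMem (by simp)]

theorem coverSum_succ_add (k a : ℕ) (w : Finset ℕ → ℕ) :
    coverSum k w (a + 1) + ∑ S ∈ coverGap k a, w S = coverSum k w a := by
  rw [coverSum, coverSum, ← Finset.sum_filter_add_sum_filter_not
    ((Finset.Icc 1 k).powerset.filter (fun S => Finset.Icc 1 a ⊆ S)) (fun S => a + 1 ∈ S),
    Finset.filter_filter, Finset.filter_filter, coverGap]
  congr 2
  exact Finset.filter_congr fun S _ => Icc_succ_subset_iff

theorem meetSum_succ (k t a : ℕ) (w : Finset ℕ → ℕ) :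
    meetSum k t w (a + 1) = meetSum k t w a + ∑ S ∈ meetGap k t a, w S := by
  have hd : Disjoint ((Finset.Icc 1 k).powerset.filter
      (fun S => t ≤ (S ∩ Finset.Icc 1 a).card)) (meetGap k t a) := by
    rw [Finset.disjoint_left]
    intro S h1 h2
    have h3 := (Finset.mem_filter.1 h1).2
    have h4 := (mem_meetGap.1 h2).2.1
    omega
  rw [meetSum, meetSum, ← Finset.sum_union hd]
  congr 1
  ext S
  rw [Finset.mem_union, mem_meetGap, Finset.mem_filter, Finset.mem_filter, Finset.mem_powerset]
  by_cases h : a + 1 ∈ S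
  · rw [card_inter_Icc_succ_of_mem h]
    constructor
    · rintro ⟨h1, h2⟩
      rcases h2.eq_or_lt with h3 | h3
      · exact Or.inr ⟨h1, h3.symm, h⟩
      · exact Or.inl ⟨h1, by omega⟩
    · rintro (⟨h1, h2⟩ | ⟨h1, h2, h3⟩)
      · exact ⟨h1, by omega⟩
      · exact ⟨h1, by omega⟩
  · rw [inter_Icc_succ_of_notMem h]
    tauto

theorem shiftSet_inter_Icc {i j a : ℕ} (hi : a < i) (hj : a < j) (S : Finset ℕ) :
    shiftSet i j S ∩ Finset.Icc 1 a = S ∩ Finset.Icc 1 a := by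
  ext x
  simp only [Finset.mem_inter, Finset.mem_Icc]
  refine and_congr_left fun hx => mem_shiftSet_of_ne S ?_ ?_ <;> omega

theorem erase_inter_Icc {j a : ℕ} (hj : a < j) (S : Finset ℕ) :
    S.erase j ∩ Finset.Icc 1 a = S ∩ Finset.Icc 1 a := by
  ext x
  simp only [Finset.mem_inter, Finset.mem_Icc, Finset.mem_erase]
  refine and_congr_left fun hx => and_iff_right ?_
  omega

theorem Icc_subset_iff_inter {a : ℕ} {S : Finset ℕ} :
    Finset.Icc 1 a ⊆ S ↔ S ∩ Finset.Icc 1 a = Finset.Icc 1 a :=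
  Finset.inter_eq_right.symm

theorem erase_injOn_of_mem {a : ℕ} {S S' : Finset ℕ} (h : a ∈ S) (h' : a ∈ S')
    (he : S.erase a = S'.erase a) : S = S' := by
  rw [← Finset.insert_erase h, he, Finset.insert_erase h']

section Gaps

variable {k t a : ℕ} {w : Finset ℕ → ℕ}

theorem two_mul_sum_coverGap_succ_le (hw : IsMonotoneWeight k w) (ha : a + 2 ≤ k) :
    2 * ∑ S ∈ coverGap k (a + 1), w S ≤ ∑ S ∈ coverGap k a, w S := by
  have hp : ∀ S ∈ coverGap k (a + 1), S ⊆ Finset.Icc 1 k ∧ Finset.Icc 1 a ⊆ S ∧ a + 1 ∈ S ∧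
      a + 2 ∉ S := by
    intro S hS
    obtain ⟨h1, h2, h3⟩ := mem_coverGap.1 hS
    rw [Icc_succ_subset_iff] at h2
    exact ⟨h1, h2.1, h2.2, h3⟩
  have hk₁ : a + 1 ∈ Finset.Icc 1 k := Finset.mem_Icc.2 (by omega)
  have hk₂ : a + 2 ∈ Finset.Icc 1 k := Finset.mem_Icc.2 (by omega)
  rw [← Finset.sum_filter_add_sum_filter_not (coverGap k a) (fun S => a + 2 ∈ S), two_mul]
  refine add_le_add
    (sum_le_sum_of_injOn_le (shiftSet (a + 2) (a + 1)) (fun S hS => ?_) (fun S hS S' hS' h => ?_)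
      (fun S hS => hw.le_shift S (hp S hS).1 _ hk₂ _ hk₁))
    (sum_le_sum_of_injOn_le (fun S => S.erase (a + 1)) (fun S hS => ?_) (fun S hS S' hS' h => ?_)
      (fun S hS => hw.le_erase S (hp S hS).1 _ (hp S hS).2.2.1))
  · obtain ⟨h1, h2, h3, h4⟩ := hp S hS
    rw [Finset.mem_filter, mem_coverGap, left_mem_shiftSet, right_mem_shiftSet (by omega),
      Icc_subset_iff_inter, shiftSet_inter_Icc (by omega) (by omega), ← Icc_subset_iff_inter]
    exact ⟨⟨shiftSet_subset hk₂ h1, h2, fun h => h4 h.2⟩, Or.inr h3⟩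
  · obtain ⟨-, -, h3, h4⟩ := hp S hS
    obtain ⟨-, -, h3', h4'⟩ := hp S' hS'
    exact shiftSet_injOn_moved (by omega) ⟨h3, h4⟩ ⟨h3', h4'⟩ h
  · obtain ⟨h1, h2, h3, h4⟩ := hp S hS
    rw [Finset.mem_filter, mem_coverGap,
      Icc_subset_iff_inter, erase_inter_Icc (by omega), ← Icc_subset_iff_inter]
    exact ⟨⟨(Finset.erase_subset _ _).trans h1, h2, by simp⟩, by simp [h4]⟩
  · exact erase_injOn_of_mem (hp S hS).2.2.1 (hp S' hS').2.2.1 h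

theorem sum_meetGap_le_two_mul (hw : IsMonotoneWeight k w) (ha : a + 2 ≤ k) :
    ∑ S ∈ meetGap k t a, w S ≤ 2 * ∑ S ∈ meetGap k t (a + 1), w S := by
  have hk₁ : a + 1 ∈ Finset.Icc 1 k := Finset.mem_Icc.2 (by omega)
  have hk₂ : a + 2 ∈ Finset.Icc 1 k := Finset.mem_Icc.2 (by omega)
  rw [← Finset.sum_filter_not_add_sum_filter (meetGap k t a) (fun S => a + 2 ∈ S), two_mul]
  refine add_le_add
    (sum_le_sum_of_injOn_le (shiftSet (a + 2) (a + 1)) (fun S hS => ?_) (fun S hS S' hS' h => ?_)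
      (fun S hS => hw.le_shift S (mem_meetGap.1 (Finset.mem_filter.1 hS).1).1 _ hk₂ _ hk₁))
    (sum_le_sum_of_injOn_le (fun S => S.erase (a + 1)) (fun S hS => ?_) (fun S hS S' hS' h => ?_)
      (fun S hS => ?_))
  · obtain ⟨hS, h4⟩ := Finset.mem_filter.1 hS
    obtain ⟨h1, h2, h3⟩ := mem_meetGap.1 hS
    have h5 : a + 1 ∉ shiftSet (a + 2) (a + 1) S := by
      rw [right_mem_shiftSet (by omega)]
      exact fun h => h4 h.2
    rw [mem_meetGap, left_mem_shiftSet, inter_Icc_succ_of_notMem h5,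
      shiftSet_inter_Icc (by omega) (by omega)]
    exact ⟨shiftSet_subset hk₂ h1, h2, Or.inr h3⟩
  · obtain ⟨hS, h4⟩ := Finset.mem_filter.1 hS
    obtain ⟨hS', h4'⟩ := Finset.mem_filter.1 hS'
    exact shiftSet_injOn_moved (by omega) ⟨(mem_meetGap.1 hS).2.2, h4⟩
      ⟨(mem_meetGap.1 hS').2.2, h4'⟩ h
  · obtain ⟨hS, h4⟩ := Finset.mem_filter.1 hS
    obtain ⟨h1, h2, h3⟩ := mem_meetGap.1 hS
    rw [mem_meetGap, inter_Icc_succ_of_notMem (by simp), erase_inter_Icc (by omega)]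
    exact ⟨(Finset.erase_subset _ _).trans h1, h2, by simp [h4]⟩
  · exact erase_injOn_of_mem (mem_meetGap.1 (Finset.mem_filter.1 hS).1).2.2
      (mem_meetGap.1 (Finset.mem_filter.1 hS').1).2.2 h
  · obtain ⟨h1, -, h3⟩ := mem_meetGap.1 (Finset.mem_filter.1 hS).1
    exact hw.le_erase S h1 _ h3

theorem sum_coverGap_le_sum_meetGap (hw : IsMonotoneWeight k w) (ht : 1 ≤ t) (htk : t + 1 ≤ k) :
    ∑ S ∈ coverGap k t, w S ≤ ∑ S ∈ meetGap k t t, w S := by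
  obtain ⟨s, rfl⟩ : ∃ s, t = s + 1 := ⟨t - 1, by omega⟩
  have hk₁ : s + 1 ∈ Finset.Icc 1 k := Finset.mem_Icc.2 (by omega)
  have hk₂ : s + 1 + 1 ∈ Finset.Icc 1 k := Finset.mem_Icc.2 (by omega)
  have hp : ∀ S ∈ coverGap k (s + 1), S ⊆ Finset.Icc 1 k ∧ Finset.Icc 1 s ⊆ S ∧ s + 1 ∈ S ∧
      s + 1 + 1 ∉ S := by
    intro S hS
    obtain ⟨h1, h2, h3⟩ := mem_coverGap.1 hS
    rw [Icc_succ_subset_iff] at h2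
    exact ⟨h1, h2.1, h2.2, h3⟩
  refine sum_le_sum_of_injOn_le (shiftSet (s + 1 + 1) (s + 1)) (fun S hS => ?_)
    (fun S hS S' hS' h => ?_) (fun S hS => hw.le_shift S (hp S hS).1 _ hk₂ _ hk₁)
  · obtain ⟨h1, h2, h3, h4⟩ := hp S hS
    have h5 : s + 1 ∉ shiftSet (s + 1 + 1) (s + 1) S := by
      rw [right_mem_shiftSet (by omega)]
      exact fun h => h4 h.2
    rw [mem_meetGap, left_mem_shiftSet, inter_Icc_succ_of_notMem h5,
      shiftSet_inter_Icc (by omega) (by omega), Icc_subset_iff_inter.1 h2]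
    exact ⟨shiftSet_subset hk₂ h1, by simp, Or.inr h3⟩
  · obtain ⟨-, -, h3, h4⟩ := hp S hS
    obtain ⟨-, -, h3', h4'⟩ := hp S' hS'
    exact shiftSet_injOn_moved (by omega) ⟨h3, h4⟩ ⟨h3', h4'⟩ h

end Gaps

theorem coverSum_eq_meetSum (k t : ℕ) (w : Finset ℕ → ℕ) : coverSum k w t = meetSum k t w t := by
  rw [coverSum, meetSum]
  congr 1
  refine Finset.filter_congr fun S _ => ?_
  rw [Icc_subset_iff_inter]
  constructor
  · intro h; rw [h]; simp
  · intro h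
    exact Finset.eq_of_subset_of_card_le Finset.inter_subset_right (by simpa using h)

/-- A sequence whose increments `x - y` satisfy `x ≤ 2 x'` and `2 y' ≤ y` in consecutive steps is
monotone from the first nonnegative increment on. -/
theorem le_last_of_increment {f x y : ℕ → ℕ} {c L : ℕ}
    (hf : ∀ b, c ≤ b → b < L → f (b + 1) + y b = f b + x b)
    (hx : ∀ b, c ≤ b → b + 1 < L → x b ≤ 2 * x (b + 1))
    (hy : ∀ b, c ≤ b → b + 1 < L → 2 * y (b + 1) ≤ y b) (hcL : c ≤ L)
    (h : c < L → y c ≤ x c) : f c ≤ f L := by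
  rcases hcL.eq_or_lt with rfl | hlt
  · exact le_rfl
  have hyx : ∀ b, c ≤ b → b < L → y b ≤ x b := by
    intro b hb
    induction b, hb using Nat.le_induction with
    | base => exact h
    | succ b hb ih =>
      intro hbL
      have h1 := ih (by omega)
      have h2 := hx b hb hbL
      have h3 := hy b hb hbL
      omega
  have key : ∀ b, c ≤ b → b ≤ L → f c ≤ f b := by
    intro b hb
    induction b, hb using Nat.le_induction with
    | base => exact fun _ => le_rfl
    | succ b hb ih =>
      intro hbL
      have h1 := ih (by omega)
      have h2 := hyx b hb (by omega)
      have h3 := hf b hb (by omega)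
      omega
  exact key L hcL le_rfl

theorem le_max_of_increment {f x y : ℕ → ℕ} {c a L : ℕ}
    (hf : ∀ b, c ≤ b → b < L → f (b + 1) + y b = f b + x b)
    (hx : ∀ b, c ≤ b → b + 1 < L → x b ≤ 2 * x (b + 1))
    (hy : ∀ b, c ≤ b → b + 1 < L → 2 * y (b + 1) ≤ y b) (hca : c ≤ a) (haL : a ≤ L) :
    f a ≤ max (f c) (f L) := by
  induction a, hca using Nat.le_induction with
  | base => exact le_max_left _ _
  | succ a hca ih =>
    have h1 := ih (by omega)
    have h2 := hf a hca (by omega)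
    rcases le_total (y a) (x a) with h3 | h3
    · refine le_max_of_le_right (le_last_of_increment (fun b hb => hf b (by omega))
        (fun b hb => hx b (by omega)) (fun b hb => hy b (by omega)) haL fun hlt => ?_)
      have h4 := hx a hca hlt
      have h5 := hy a hca hlt
      omega
    · omega

section Comparison

variable {k t l₁ l₂ : ℕ} {w₁ w₂ : Finset ℕ → ℕ}

theorem coverSum_add_meetSum_increment (a : ℕ) :
    coverSum k w₁ (a + 1) + meetSum k t w₂ (a + 1) + ∑ S ∈ coverGap k a, w₁ S =
      coverSum k w₁ a + meetSum k t w₂ a + ∑ S ∈ meetGap k t a, w₂ S := by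
  rw [meetSum_succ, ← coverSum_succ_add k a w₁]
  omega

theorem coverSum_add_meetSum_le_max (hw₁ : IsMonotoneWeight k w₁) (hw₂ : IsMonotoneWeight k w₂)
    (hk : l₁ ≤ k) {a : ℕ} (hta : t ≤ a) (hal : a ≤ l₁) :
    coverSum k w₁ a + meetSum k t w₂ a ≤
      max (coverSum k w₁ t + meetSum k t w₂ t) (coverSum k w₁ l₁ + meetSum k t w₂ l₁) :=
  le_max_of_increment (f := fun a => coverSum k w₁ a + meetSum k t w₂ a)
    (fun b _ _ => coverSum_add_meetSum_increment b)
    (fun _ _ _ => sum_meetGap_le_two_mul hw₂ (by omega))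
    (fun _ _ _ => two_mul_sum_coverGap_succ_le hw₁ (by omega)) hta hal

theorem coverSum_add_meetSum_le_last (hw₁ : IsMonotoneWeight k w₁) (hw₂ : IsMonotoneWeight k w₂)
    (hk : l₁ ≤ k) (ht : 1 ≤ t) (htl : t ≤ l₁)
    (h : ∑ S ∈ coverGap k t, w₁ S ≤ ∑ S ∈ coverGap k t, w₂ S) :
    coverSum k w₁ t + meetSum k t w₂ t ≤ coverSum k w₁ l₁ + meetSum k t w₂ l₁ :=
  le_last_of_increment (f := fun a => coverSum k w₁ a + meetSum k t w₂ a)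
    (fun b _ _ => coverSum_add_meetSum_increment b)
    (fun _ _ _ => sum_meetGap_le_two_mul hw₂ (by omega))
    (fun _ _ _ => two_mul_sum_coverGap_succ_le hw₁ (by omega)) htl
    (fun _ => h.trans (sum_coverGap_le_sum_meetGap hw₂ ht (by omega)))

theorem coverSum_add_meetSum_start_le (hw₁ : IsMonotoneWeight k w₁)
    (hw₂ : IsMonotoneWeight k w₂) (hk₁ : l₁ ≤ k) (hk₂ : l₂ ≤ k) (ht : 1 ≤ t) (htl₁ : t ≤ l₁)
    (htl₂ : t ≤ l₂) :
    coverSum k w₁ t + meetSum k t w₂ t ≤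
      max (coverSum k w₁ l₁ + meetSum k t w₂ l₁) (coverSum k w₂ l₂ + meetSum k t w₁ l₂) := by
  rcases le_total (∑ S ∈ coverGap k t, w₁ S) (∑ S ∈ coverGap k t, w₂ S) with h | h
  · exact le_max_of_le_left (coverSum_add_meetSum_le_last hw₁ hw₂ hk₁ ht htl₁ h)
  · refine le_max_of_le_right (le_trans (le_of_eq ?_)
      (coverSum_add_meetSum_le_last hw₂ hw₁ hk₂ ht htl₂ h))
    rw [coverSum_eq_meetSum, coverSum_eq_meetSum, add_comm]

/-- The extremal bound for the total weight of cross `t`-intersecting families of subsets of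
`{1, …, k}`. -/
theorem weight_le_max_of_crossOn (hw₁ : IsMonotoneWeight k w₁) (hw₂ : IsMonotoneWeight k w₂)
    (hk₁ : l₁ ≤ k) (hk₂ : l₂ ≤ k) (ht : 1 ≤ t) (htl₁ : t ≤ l₁) (htl₂ : t ≤ l₂)
    (F G : Finset (Finset ℕ)) (hF : F ⊆ smallSets k l₁) (hG : G ⊆ smallSets k l₂)
    (hFn : F.Nonempty) (hGn : G.Nonempty) (hc : CrossOn t (Finset.Icc 1 k) F G) :
    ∑ A ∈ F, w₁ A + ∑ B ∈ G, w₂ B ≤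
      max (coverSum k w₁ l₁ + meetSum k t w₂ l₁) (coverSum k w₂ l₂ + meetSum k t w₁ l₂) := by
  refine weight_le_of_crossOn hw₁ hw₂ (fun b htb hb => ?_) (fun b htb hb => ?_) (htl₁.trans hk₁)
    le_rfl F G hF hG hFn hGn hc
  · refine (coverSum_add_meetSum_le_max hw₁ hw₂ hk₁ htb hb).trans (max_le ?_ (le_max_left _ _))
    exact coverSum_add_meetSum_start_le hw₁ hw₂ hk₁ hk₂ ht htl₁ htl₂
  · refine (coverSum_add_meetSum_le_max hw₂ hw₁ hk₂ htb hb).trans (max_le ?_ (le_max_right _ _))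
    rw [max_comm]
    exact coverSum_add_meetSum_start_le hw₂ hw₁ hk₂ hk₁ ht htl₂ htl₁

end Comparison

/-- The index of the block of size `n` containing `x`. -/
def blockIndex (n x : ℕ) : ℕ := (x - 1) / n + 1

theorem mem_Xblock_iff {n i x : ℕ} (hn : 1 ≤ n) (hi : 1 ≤ i) :
    x ∈ Xblock n i ↔ 1 ≤ x ∧ blockIndex n x = i := by
  obtain ⟨m, rfl⟩ : ∃ m, i = m + 1 := ⟨i - 1, by omega⟩
  have key : 1 ≤ x → ((x - 1) / n = m ↔ m * n ≤ x - 1 ∧ x - 1 < (m + 1) * n) := fun _ => by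
    rw [← Nat.le_div_iff_mul_le hn, ← Nat.div_lt_iff_lt_mul hn]
    omega
  simp only [Xblock, blockIndex, Finset.mem_Ioc, Nat.add_sub_cancel]
  constructor
  · rintro ⟨h1, h2⟩
    exact ⟨by omega, by rw [(key (by omega)).2 ⟨by omega, by omega⟩]⟩
  · rintro ⟨h1, h2⟩
    have := (key h1).1 (by omega)
    omega

theorem le_mul_iff_blockIndex_le {n k x : ℕ} (hn : 1 ≤ n) (hx : 1 ≤ x) :
    x ≤ n * k ↔ blockIndex n x ≤ k := by
  have h : (x - 1) / n < k ↔ x - 1 < k * n := Nat.div_lt_iff_lt_mul hn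
  rw [mul_comm, blockIndex]
  omega

theorem mem_Hfam_iff {n k l : ℕ} (hn : 1 ≤ n) {A : Finset ℕ} :
    A ∈ Hfam n k l ↔ (∀ x ∈ A, 1 ≤ x ∧ blockIndex n x ≤ k) ∧ A.card = l ∧
      Set.InjOn (blockIndex n) (A : Set ℕ) := by
  simp only [Hfam, Finset.mem_filter, Finset.mem_powerset]
  have h0 : A ⊆ Finset.Icc 1 (n * k) ↔ ∀ x ∈ A, 1 ≤ x ∧ blockIndex n x ≤ k := by
    refine forall₂_congr fun x _ => ?_
    rw [Finset.mem_Icc]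
    exact and_congr_right fun hx => le_mul_iff_blockIndex_le hn hx
  rw [h0]
  refine and_congr_right fun hA => and_congr_right fun _ => ?_
  constructor
  · intro h x hx y hy hxy
    have hi : blockIndex n x ∈ Finset.Icc 1 k :=
      Finset.mem_Icc.2 ⟨by simp [blockIndex], (hA x hx).2⟩
    refine Finset.card_le_one.1 (h _ hi) x ?_ y ?_ <;>
      rw [Finset.mem_inter, mem_Xblock_iff hn (Finset.mem_Icc.1 hi).1]
    · exact ⟨hx, (hA x hx).1, rfl⟩
    · exact ⟨hy, (hA y hy).1, hxy.symm⟩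
  · intro h i hi
    refine Finset.card_le_one.2 fun x hx y hy => ?_
    rw [Finset.mem_inter, mem_Xblock_iff hn (Finset.mem_Icc.1 hi).1] at hx hy
    exact h hx.1 hy.1 (hx.2.2.trans hy.2.2.symm)

theorem one_le_vmin (n i : ℕ) : 1 ≤ vmin n i := Nat.le_add_left _ _

theorem blockIndex_mul_add {n i r : ℕ} (hr : r < n) (hi : 1 ≤ i) :
    blockIndex n ((i - 1) * n + r + 1) = i := by
  have h : ((i - 1) * n + r) / n = i - 1 := by
    rw [mul_comm, Nat.mul_add_div (by omega), Nat.div_eq_of_lt hr, add_zero]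
  rw [blockIndex, Nat.add_sub_cancel, h]
  omega

theorem blockIndex_vmin {n i : ℕ} (hn : 1 ≤ n) (hi : 1 ≤ i) : blockIndex n (vmin n i) = i :=
  blockIndex_mul_add (r := 0) hn hi

theorem blockIndex_vmin_add_one {n i : ℕ} (hn : 2 ≤ n) (hi : 1 ≤ i) :
    blockIndex n (vmin n i + 1) = i :=
  blockIndex_mul_add (r := 1) hn hi

theorem vmin_injOn {n : ℕ} (hn : 1 ≤ n) {i j : ℕ} (hi : 1 ≤ i) (hj : 1 ≤ j)
    (h : vmin n i = vmin n j) : i = j := by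
  rw [← blockIndex_vmin hn hi, h, blockIndex_vmin hn hj]

theorem image_mem_Hfam {n k l : ℕ} (hn : 1 ≤ n) {φ π : ℕ → ℕ}
    (hφ : ∀ x, 1 ≤ x → 1 ≤ φ x ∧ blockIndex n (φ x) = π (blockIndex n x))
    (hπ : ∀ i, 1 ≤ i → i ≤ k → π i ≤ k) (hinj : Function.Injective π) {A : Finset ℕ}
    (hA : A ∈ Hfam n k l) : A.image φ ∈ Hfam n k l := by
  rw [mem_Hfam_iff hn] at hA ⊢
  obtain ⟨h1, h2, h3⟩ := hA
  refine ⟨?_, ?_, ?_⟩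
  · intro y hy
    obtain ⟨x, hx, rfl⟩ := Finset.mem_image.1 hy
    obtain ⟨h4, h5⟩ := hφ x (h1 x hx).1
    exact ⟨h4, h5 ▸ hπ _ (by simp [blockIndex]) (h1 x hx).2⟩
  · rw [Finset.card_image_of_injOn, h2]
    intro x hx y hy hxy
    refine h3 hx hy (hinj ?_)
    rw [← (hφ x (h1 x hx).1).2, ← (hφ y (h1 y hy).1).2, hxy]
  · intro x' hx' y' hy' hxy
    obtain ⟨x, hx, rfl⟩ := Finset.mem_image.1 (Finset.mem_coe.1 hx')
    obtain ⟨y, hy, rfl⟩ := Finset.mem_image.1 (Finset.mem_coe.1 hy')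
    rw [(hφ x (h1 x hx).1).2, (hφ y (h1 y hy).1).2] at hxy
    rw [h3 hx hy (hinj hxy)]

theorem image_swap_mem_Hfam {n k l u v : ℕ} (hn : 1 ≤ n) (hu : 1 ≤ u) (hv : 1 ≤ v)
    (huv : blockIndex n u = blockIndex n v) {A : Finset ℕ} (hA : A ∈ Hfam n k l) :
    A.image (Equiv.swap u v) ∈ Hfam n k l := by
  refine image_mem_Hfam (π := id) hn (fun x hx => ?_) (fun _ _ h => h) Function.injective_id hA
  rw [Equiv.swap_apply_def]
  split_ifs with h1 h2
  · exact ⟨hv, by rw [h1, ← huv]; rfl⟩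
  · exact ⟨hu, by rw [h2, huv]; rfl⟩
  · exact ⟨hx, rfl⟩

theorem mem_image_swap {u v x : ℕ} {A : Finset ℕ} :
    x ∈ A.image (Equiv.swap u v) ↔ Equiv.swap u v x ∈ A := by
  constructor
  · intro h
    obtain ⟨y, hy, rfl⟩ := Finset.mem_image.1 h
    rwa [Equiv.swap_apply_self]
  · intro h
    exact Finset.mem_image.2 ⟨_, h, Equiv.swap_apply_self _ _ _⟩

theorem shiftSet_mem_Hfam {n k l u v : ℕ} (hn : 1 ≤ n) (hu : 1 ≤ u) (hv : 1 ≤ v)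
    (huv : blockIndex n u = blockIndex n v) {A : Finset ℕ} (hA : A ∈ Hfam n k l) :
    shiftSet u v A ∈ Hfam n k l := by
  by_cases h : v ∈ A ∧ u ∉ A
  · have hne : u ≠ v := by rintro rfl; exact h.2 h.1
    have : shiftSet u v A = A.image (Equiv.swap u v) := by
      ext x
      rw [mem_image_swap]
      by_cases hxu : x = u
      · subst hxu; simp [left_mem_shiftSet, h.1]
      by_cases hxv : x = v
      · subst hxv; simp [right_mem_shiftSet hne, h.2]
      rw [mem_shiftSet_of_ne A hxu hxv, Equiv.swap_apply_of_ne_of_ne hxu hxv]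
    rw [this]
    exact image_swap_mem_Hfam hn hu hv huv hA
  · rwa [shiftSet, if_neg h]

/-- Exchange the blocks with indices `i` and `j`, preserving the position inside the block. -/
def blockSwap (n i j x : ℕ) : ℕ := (Equiv.swap i j (blockIndex n x) - 1) * n + (x - 1) % n + 1

theorem one_le_swap {i j m : ℕ} (hi : 1 ≤ i) (hj : 1 ≤ j) (hm : 1 ≤ m) :
    1 ≤ Equiv.swap i j m := by
  rw [Equiv.swap_apply_def]
  split_ifs <;> assumption

theorem blockIndex_blockSwap {n i j : ℕ} (hn : 1 ≤ n) (hi : 1 ≤ i) (hj : 1 ≤ j) (x : ℕ) :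
    blockIndex n (blockSwap n i j x) = Equiv.swap i j (blockIndex n x) :=
  blockIndex_mul_add (Nat.mod_lt _ hn) (one_le_swap hi hj (by simp [blockIndex]))

theorem blockSwap_blockSwap {n i j x : ℕ} (hn : 1 ≤ n) (hi : 1 ≤ i) (hj : 1 ≤ j) (hx : 1 ≤ x) :
    blockSwap n i j (blockSwap n i j x) = x := by
  rw [blockSwap, blockIndex_blockSwap hn hi hj, Equiv.swap_apply_self, blockSwap,
    Nat.add_sub_cancel, mul_comm (Equiv.swap i j _ - 1) n, Nat.mul_add_mod, Nat.mod_mod,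
    blockIndex, Nat.add_sub_cancel, Nat.div_add_mod']
  omega

theorem blockSwap_vmin {n i j m : ℕ} (hn : 1 ≤ n) (hm : 1 ≤ m) :
    blockSwap n i j (vmin n m) = vmin n (Equiv.swap i j m) := by
  rw [blockSwap, blockIndex_vmin hn hm, vmin, vmin, Nat.add_sub_cancel, Nat.mul_mod_left, add_zero]

theorem image_blockSwap_mem_Hfam {n k l i j : ℕ} (hn : 1 ≤ n) (hi : i ∈ Finset.Icc 1 k)
    (hj : j ∈ Finset.Icc 1 k) {A : Finset ℕ} (hA : A ∈ Hfam n k l) :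
    A.image (blockSwap n i j) ∈ Hfam n k l := by
  rw [Finset.mem_Icc] at hi hj
  refine image_mem_Hfam (π := Equiv.swap i j) hn
    (fun x _ => ⟨Nat.le_add_left _ _, blockIndex_blockSwap hn hi.1 hj.1 x⟩) (fun m _ hm => ?_)
    (Equiv.injective _) hA
  rw [Equiv.swap_apply_def]
  split_ifs
  · exact hj.2
  · exact hi.2
  · exact hm

theorem image_blockSwap_image {n k l i j : ℕ} (hn : 1 ≤ n) (hi : 1 ≤ i) (hj : 1 ≤ j)
    {A : Finset ℕ} (hA : A ∈ Hfam n k l) :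
    (A.image (blockSwap n i j)).image (blockSwap n i j) = A := by
  rw [Finset.image_image]
  conv_rhs => rw [← Finset.image_id (s := A)]
  exact Finset.image_congr fun x hx =>
    blockSwap_blockSwap hn hi hj (((mem_Hfam_iff hn).1 hA).1 x hx).1

/-- The indices of the blocks whose minimum lies in `A`. -/
def minTrace (n k : ℕ) (A : Finset ℕ) : Finset ℕ :=
  (Finset.Icc 1 k).filter (fun i => vmin n i ∈ A)

/-- The number of separated sets with a prescribed trace on the block minima. -/
noncomputable def traceWeight (n k l : ℕ) (S : Finset ℕ) : ℕ :=
  ((Hfam n k l).filter (fun A => minTrace n k A = S)).card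

theorem mem_minTrace {n k i : ℕ} {A : Finset ℕ} :
    i ∈ minTrace n k A ↔ (1 ≤ i ∧ i ≤ k) ∧ vmin n i ∈ A := by
  rw [minTrace, Finset.mem_filter, Finset.mem_Icc]

theorem minTrace_image_swap {n k l a : ℕ} (hn : 2 ≤ n) {A : Finset ℕ} (hA : A ∈ Hfam n k l)
    (ha : a ∈ minTrace n k A) :
    minTrace n k (A.image (Equiv.swap (vmin n a) (vmin n a + 1))) = (minTrace n k A).erase a := by
  obtain ⟨⟨ha1, hak⟩, hav⟩ := mem_minTrace.1 ha
  ext m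
  rw [Finset.mem_erase, mem_minTrace, mem_minTrace, mem_image_swap]
  by_cases hm : m = a
  · subst hm
    rw [Equiv.swap_apply_left]
    have : vmin n m + 1 ∉ A := fun h => by
      have := ((mem_Hfam_iff (by omega)).1 hA).2.2 h hav
        ((blockIndex_vmin_add_one hn ha1).trans (blockIndex_vmin (by omega) ha1).symm)
      omega
    simp [this]
  · rw [and_iff_right hm]
    refine and_congr_right fun hmk => ?_
    rw [Equiv.swap_apply_of_ne_of_ne]
    · exact fun h => hm (vmin_injOn (by omega) hmk.1 ha1 h)
    · intro h
      have := congrArg (blockIndex n) h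
      rw [blockIndex_vmin (by omega) hmk.1, blockIndex_vmin_add_one hn ha1] at this
      exact hm this

theorem vmin_mem_image_blockSwap {n k l i j m : ℕ} (hn : 1 ≤ n) (hi : 1 ≤ i) (hj : 1 ≤ j)
    (hm : 1 ≤ m) {A : Finset ℕ} (hA : A ∈ Hfam n k l) :
    vmin n m ∈ A.image (blockSwap n i j) ↔ vmin n (Equiv.swap i j m) ∈ A := by
  rw [← blockSwap_vmin hn hm]
  constructor
  · intro h
    obtain ⟨x, hx, hxm⟩ := Finset.mem_image.1 h
    rwa [← hxm, blockSwap_blockSwap hn hi hj (((mem_Hfam_iff hn).1 hA).1 x hx).1]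
  · intro h
    exact Finset.mem_image.2 ⟨_, h, blockSwap_blockSwap hn hi hj (one_le_vmin n m)⟩

theorem minTrace_image_blockSwap {n k l i j : ℕ} (hn : 1 ≤ n) (hi : i ∈ Finset.Icc 1 k)
    (hj : j ∈ Finset.Icc 1 k) {A : Finset ℕ} (hA : A ∈ Hfam n k l) (hjA : j ∈ minTrace n k A)
    (hiA : i ∉ minTrace n k A) :
    minTrace n k (A.image (blockSwap n i j)) = shiftSet i j (minTrace n k A) := by
  have hij : i ≠ j := by rintro rfl; exact hiA hjA
  rw [Finset.mem_Icc] at hi hj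
  ext m
  by_cases hmi : m = i
  · subst hmi
    rw [left_mem_shiftSet, mem_minTrace, vmin_mem_image_blockSwap hn hi.1 hj.1 hi.1 hA,
      Equiv.swap_apply_left]
    simp only [hjA, or_true, iff_true]
    exact ⟨hi, (mem_minTrace.1 hjA).2⟩
  by_cases hmj : m = j
  · subst hmj
    rw [right_mem_shiftSet hij, mem_minTrace, vmin_mem_image_blockSwap hn hi.1 hj.1 hj.1 hA,
      Equiv.swap_apply_right]
    simp only [hiA, and_false, iff_false]
    exact fun h => hiA (mem_minTrace.2 ⟨hi, h.2⟩)
  rw [mem_shiftSet_of_ne _ hmi hmj, mem_minTrace, mem_minTrace]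
  refine and_congr_right fun hm => ?_
  rw [vmin_mem_image_blockSwap hn hi.1 hj.1 hm.1 hA, Equiv.swap_apply_of_ne_of_ne hmi hmj]

theorem isMonotoneWeight_traceWeight {n : ℕ} (hn : 2 ≤ n) (k l : ℕ) :
    IsMonotoneWeight k (traceWeight n k l) where
  le_erase S hS a ha := by
    have ha1 : 1 ≤ a := (Finset.mem_Icc.1 (hS ha)).1
    refine Finset.card_le_card_of_injOn
      (fun A => A.image (Equiv.swap (vmin n a) (vmin n a + 1))) (fun A hA => ?_)
      ((Finset.image_injective (Equiv.injective _)).injOn)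
    obtain ⟨hAH, rfl⟩ := Finset.mem_filter.1 (Finset.mem_coe.1 hA)
    refine Finset.mem_coe.2 (Finset.mem_filter.2 ⟨?_, minTrace_image_swap hn hAH ha⟩)
    refine image_swap_mem_Hfam (by omega) (one_le_vmin _ _) (by omega) ?_ hAH
    rw [blockIndex_vmin (by omega) ha1, blockIndex_vmin_add_one hn ha1]
  le_shift S hS i hi j hj := by
    have hn1 : 1 ≤ n := by omega
    by_cases h : j ∈ S ∧ i ∉ S
    · refine Finset.card_le_card_of_injOn (fun A => A.image (blockSwap n i j))
        (fun A hA => ?_) (fun A hA B hB hAB => ?_)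
      · obtain ⟨hAH, rfl⟩ := Finset.mem_filter.1 (Finset.mem_coe.1 hA)
        exact Finset.mem_coe.2 (Finset.mem_filter.2 ⟨image_blockSwap_mem_Hfam hn1 hi hj hAH,
          minTrace_image_blockSwap hn1 hi hj hAH h.1 h.2⟩)
      · have hi1 := (Finset.mem_Icc.1 hi).1
        have hj1 := (Finset.mem_Icc.1 hj).1
        simp only at hAB
        rw [← image_blockSwap_image hn1 hi1 hj1 (Finset.mem_filter.1 (Finset.mem_coe.1 hA)).1, hAB,
          image_blockSwap_image hn1 hi1 hj1 (Finset.mem_filter.1 (Finset.mem_coe.1 hB)).1]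
    · rw [shiftSet, if_neg h]

theorem sum_traceWeight (n k l : ℕ) (p : Finset ℕ → Prop) [DecidablePred p] :
    ∑ S ∈ (Finset.Icc 1 k).powerset.filter p, traceWeight n k l S =
      ((Hfam n k l).filter (fun A => p (minTrace n k A))).card := by
  rw [Finset.card_eq_sum_card_fiberwise (f := minTrace n k)
    (t := (Finset.Icc 1 k).powerset.filter p)]
  · refine Finset.sum_congr rfl fun S hS => ?_
    rw [traceWeight, Finset.filter_filter]
    congr 1
    refine Finset.filter_congr fun A _ => ?_
    constructor
    · rintro rfl
      exact ⟨(Finset.mem_filter.1 hS).2, rfl⟩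
    · exact fun h => h.2
  · intro A hA
    exact Finset.mem_coe.2 (Finset.mem_filter.2 ⟨Finset.mem_powerset.2 (Finset.filter_subset _ _),
      (Finset.mem_filter.1 (Finset.mem_coe.1 hA)).2⟩)

theorem inter_Vset_eq_image {n k a : ℕ} (hak : a ≤ k) (A : Finset ℕ) :
    A ∩ Vset n a = (minTrace n k A ∩ Finset.Icc 1 a).image (vmin n) := by
  ext x
  simp only [Vset, Finset.mem_inter, Finset.mem_image, mem_minTrace, Finset.mem_Icc]
  constructor
  · rintro ⟨h1, i, h2, rfl⟩
    exact ⟨i, ⟨⟨⟨h2.1, by omega⟩, h1⟩, h2⟩, rfl⟩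
  · rintro ⟨i, ⟨⟨h1, h2⟩, h3⟩, rfl⟩
    exact ⟨h2, i, h3, rfl⟩

theorem card_image_vmin {n : ℕ} (hn : 1 ≤ n) {S : Finset ℕ} (hS : ∀ i ∈ S, 1 ≤ i) :
    (S.image (vmin n)).card = S.card :=
  Finset.card_image_of_injOn fun i hi j hj h => vmin_injOn hn (hS i hi) (hS j hj) h

theorem meetSum_traceWeight {n k l t a : ℕ} (hn : 1 ≤ n) (hak : a ≤ k) :
    meetSum k t (traceWeight n k l) a =
      ((Hfam n k l).filter (fun A => t ≤ (A ∩ Vset n a).card)).card := by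
  rw [meetSum, sum_traceWeight]
  congr 1
  refine Finset.filter_congr fun A _ => ?_
  rw [inter_Vset_eq_image hak, card_image_vmin hn]
  exact fun i hi => (Finset.mem_Icc.1 (Finset.mem_inter.1 hi).2).1

theorem coverSum_traceWeight {n k l a : ℕ} (hak : a ≤ k) :
    coverSum k (traceWeight n k l) a =
      ((Hfam n k l).filter (fun A => Vset n a ⊆ A)).card := by
  rw [coverSum, sum_traceWeight]
  congr 1
  refine Finset.filter_congr fun A _ => ?_
  rw [Vset, Finset.image_subset_iff]
  refine forall₂_congr fun i hi => ?_
  rw [Finset.mem_Icc] at hi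
  rw [mem_minTrace, and_iff_right ⟨hi.1, by omega⟩]

theorem card_Vset {n : ℕ} (hn : 1 ≤ n) (a : ℕ) : (Vset n a).card = a := by
  rw [Vset, card_image_vmin hn fun i hi => (Finset.mem_Icc.1 hi).1]
  simp

theorem coverSum_traceWeight_self_le {n k l : ℕ} (hn : 1 ≤ n) (hlk : l ≤ k) :
    coverSum k (traceWeight n k l) l ≤ 1 := by
  rw [coverSum_traceWeight hlk, ← Finset.card_singleton (Vset n l)]
  refine Finset.card_le_card fun A hA => ?_
  obtain ⟨hA, hV⟩ := Finset.mem_filter.1 hA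
  rw [Finset.mem_singleton]
  refine (Finset.eq_of_subset_of_card_le hV ?_).symm
  rw [card_Vset hn, ((mem_Hfam_iff hn).1 hA).2.1]

theorem minTrace_mem_smallSets {n k l : ℕ} (hn : 1 ≤ n) {A : Finset ℕ} (hA : A ∈ Hfam n k l) :
    minTrace n k A ∈ smallSets k l := by
  refine Finset.mem_filter.2 ⟨Finset.mem_powerset.2 (Finset.filter_subset _ _), ?_⟩
  rw [← ((mem_Hfam_iff hn).1 hA).2.1]
  refine Finset.card_le_card_of_injOn (vmin n) (fun i hi => (mem_minTrace.1 hi).2)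
    fun i hi j hj h => ?_
  exact vmin_injOn hn (mem_minTrace.1 hi).1.1 (mem_minTrace.1 hj).1.1 h

theorem card_le_sum_traceWeight {n k l : ℕ} {F : Finset (Finset ℕ)} (hF : F ⊆ Hfam n k l) :
    F.card ≤ ∑ S ∈ F.image (minTrace n k), traceWeight n k l S := by
  rw [Finset.card_eq_sum_card_image (minTrace n k) F]
  exact Finset.sum_le_sum fun S _ => Finset.card_le_card (Finset.filter_subset_filter _ hF)

/-- In cross intersecting families stable under moving elements to the minima of their blocks, the
intersections are already large on the block minima. -/
theorem le_card_inter_Vset {n k l l' t : ℕ} (hn : 1 ≤ n) {F G : Finset (Finset ℕ)}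
    (hF : F ⊆ Hfam n k l) (hG : G ⊆ Hfam n k l')
    (hc : CrossOn t (Finset.Icc 1 (n * k)) F G)
    (hst : ∀ x, x ≤ n * k → vmin n (blockIndex n x) < x →
      ∀ A ∈ F, shiftSet (vmin n (blockIndex n x)) x A ∈ F)
    {A B : Finset ℕ} (hA : A ∈ F) (hB : B ∈ G) : t ≤ (A ∩ B ∩ Vset n k).card := by
  induction hN : ((A ∩ B) \ Vset n k).card using Nat.strong_induction_on generalizing A with
  | _ N ih =>
    obtain ⟨hA1, -, hA3⟩ := (mem_Hfam_iff hn).1 (hF hA)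
    obtain ⟨hB1, -, hB3⟩ := (mem_Hfam_iff hn).1 (hG hB)
    rcases ((A ∩ B) \ Vset n k).eq_empty_or_nonempty with he | ⟨x, hx⟩
    · refine (hc A hA B hB).trans (Finset.card_le_card fun x hx => ?_)
      rw [Finset.mem_inter] at hx
      exact Finset.mem_inter.2 ⟨hx.1, Finset.sdiff_eq_empty_iff_subset.1 he hx.1⟩
    obtain ⟨hxAB, hxV⟩ := Finset.mem_sdiff.1 hx
    obtain ⟨hxA, hxB⟩ := Finset.mem_inter.1 hxAB
    obtain ⟨hx1, hxk⟩ := hA1 x hxA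
    set v := vmin n (blockIndex n x) with hv
    have hb1 : 1 ≤ blockIndex n x := by simp [blockIndex]
    have hvV : v ∈ Vset n k := Finset.mem_image.2 ⟨_, Finset.mem_Icc.2 ⟨hb1, hxk⟩, rfl⟩
    have hvx : v ≠ x := fun h => hxV (h ▸ hvV)
    have hvlt : v < x := by
      refine lt_of_le_of_ne ?_ hvx
      have := Nat.div_mul_le_self (x - 1) n
      rw [hv, vmin, blockIndex, Nat.add_sub_cancel]
      omega
    have hbv : blockIndex n v = blockIndex n x := blockIndex_vmin hn hb1
    have hvA : v ∉ A := fun h => hvx (hA3 h hxA hbv)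
    have hvB : v ∉ B := fun h => hvx (hB3 h hxB hbv)
    have hA' := hst x ((le_mul_iff_blockIndex_le hn hx1).2 hxk) hvlt A hA
    have hinter : shiftSet v x A ∩ B = (A ∩ B).erase x := by
      ext y
      by_cases hyv : y = v
      · rw [hyv]; simp [hvB]
      by_cases hyx : y = x
      · rw [hyx]; simp [right_mem_shiftSet hvx, hvA]
      simp [mem_shiftSet_of_ne A hyv hyx, hyx]
    have hlt : ((shiftSet v x A ∩ B) \ Vset n k).card < N := by
      rw [← hN, hinter]
      refine Finset.card_lt_card ((Finset.ssubset_iff_of_subset ?_).2 ⟨x, hx, by simp⟩)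
      exact Finset.sdiff_subset_sdiff (Finset.erase_subset _ _) le_rfl
    refine (ih _ hlt hA' rfl).trans (Finset.card_le_card ?_)
    rw [hinter]
    exact Finset.inter_subset_inter_right (Finset.erase_subset _ _)

theorem CrossOn.image_minTrace {n k l l' t : ℕ} (hn : 1 ≤ n) {F G : Finset (Finset ℕ)}
    (hF : F ⊆ Hfam n k l) (hG : G ⊆ Hfam n k l')
    (hc : CrossOn t (Finset.Icc 1 (n * k)) F G)
    (hst : ∀ x, x ≤ n * k → vmin n (blockIndex n x) < x →
      ∀ A ∈ F, shiftSet (vmin n (blockIndex n x)) x A ∈ F) :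
    CrossOn t (Finset.Icc 1 k) (F.image (minTrace n k)) (G.image (minTrace n k)) := by
  intro S hS S' hS'
  obtain ⟨A, hA, rfl⟩ := Finset.mem_image.1 hS
  obtain ⟨B, hB, rfl⟩ := Finset.mem_image.1 hS'
  refine (le_card_inter_Vset hn hF hG hc hst hA hB).trans ?_
  rw [inter_Vset_eq_image le_rfl]
  refine Finset.card_image_le.trans (Finset.card_le_card fun i hi => ?_)
  simp only [Finset.mem_inter, mem_minTrace] at hi ⊢
  tauto

theorem card_add_card_le_max {n k l l' t : ℕ} (hn : 2 ≤ n) (hkl : l ≤ k) (hkl' : l' ≤ k)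
    (ht : 1 ≤ t) (htl : t ≤ l) (htl' : t ≤ l') {F G : Finset (Finset ℕ)}
    (hF : F ⊆ Hfam n k l) (hG : G ⊆ Hfam n k l') (hFn : F.Nonempty) (hGn : G.Nonempty)
    (hc : ∀ A ∈ F, ∀ B ∈ G, t ≤ (A ∩ B).card) :
    F.card + G.card ≤
      max (coverSum k (traceWeight n k l) l + meetSum k t (traceWeight n k l') l)
        (coverSum k (traceWeight n k l') l' + meetSum k t (traceWeight n k l) l') := by
  have hn1 : 1 ≤ n := by omega
  have hc₀ : CrossOn t (Finset.Icc 1 (n * k)) F G := by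
    intro A hA B hB
    have hAK : A ⊆ Finset.Icc 1 (n * k) := fun x hx =>
      have h := ((mem_Hfam_iff hn1).1 (hF hA)).1 x hx
      Finset.mem_Icc.2 ⟨h.1, (le_mul_iff_blockIndex_le hn1 h.1).2 h.2⟩
    rw [Finset.inter_eq_left.2 (Finset.inter_subset_left.trans hAK)]
    exact hc A hA B hB
  have hR : ∀ v x, x ≤ n * k ∧ vmin n (blockIndex n x) < x ∧ v = vmin n (blockIndex n x) →
      1 ≤ v ∧ v < x ∧ x ≤ n * k ∧ blockIndex n v = blockIndex n x := by
    rintro v x ⟨h1, h2, rfl⟩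
    exact ⟨one_le_vmin _ _, h2, h1, blockIndex_vmin hn1 (by simp [blockIndex])⟩
  have hU : ∀ m v x, x ≤ n * k ∧ vmin n (blockIndex n x) < x ∧ v = vmin n (blockIndex n x) →
      ∀ A ∈ Hfam n k m, shiftSet v x A ∈ Hfam n k m := by
    intro m v x h A hA
    obtain ⟨h1, h2, -, h4⟩ := hR v x h
    exact shiftSet_mem_Hfam hn1 h1 (by omega) h4 hA
  obtain ⟨F', G', hF', hG', hFn', hGn', hc', hle₁, hle₂, hst, -⟩ :=
    exists_stable
      (fun v x => x ≤ n * k ∧ vmin n (blockIndex n x) < x ∧ v = vmin n (blockIndex n x))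
      t (Finset.Icc 1 (n * k)) (Hfam n k l) (Hfam n k l') (fun _ => 1) (fun _ => 1)
      (fun v x h => (hR v x h).2.1)
      (fun v x h => by
        obtain ⟨h1, h2, h3, -⟩ := hR v x h
        exact ⟨Finset.mem_Icc.2 ⟨h1, by omega⟩, Finset.mem_Icc.2 ⟨by omega, h3⟩⟩)
      (hU l) (hU l') (fun _ _ _ _ _ => le_rfl) (fun _ _ _ _ _ => le_rfl)
      F G hF hG hFn hGn hc₀
  rw [← Finset.card_eq_sum_ones, ← Finset.card_eq_sum_ones] at hle₁ hle₂
  refine (add_le_add (hle₁.trans (card_le_sum_traceWeight hF'))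
    (hle₂.trans (card_le_sum_traceWeight hG'))).trans ?_
  refine weight_le_max_of_crossOn (isMonotoneWeight_traceWeight hn k l)
    (isMonotoneWeight_traceWeight hn k l') hkl hkl' ht htl htl' _ _
    (Finset.image_subset_iff.2 fun A hA => minTrace_mem_smallSets hn1 (hF' hA))
    (Finset.image_subset_iff.2 fun A hA => minTrace_mem_smallSets hn1 (hG' hA))
    (hFn'.image _) (hGn'.image _) ?_
  exact CrossOn.image_minTrace hn1 hF' hG' hc' fun x h1 h2 => hst _ x ⟨h1, h2, rfl⟩

theorem separated_cross_t_intersecting (n k l l' t : ℕ)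
    (hn : 2 ≤ n) (hkl : l ≤ k) (hll : l' ≤ l) (htl : t ≤ l') (ht : 1 ≤ t)
    (F G : Finset (Finset ℕ))
    (hF : F ⊆ Hfam n k l) (hG : G ⊆ Hfam n k l')
    (hFne : F.Nonempty) (hGne : G.Nonempty)
    (hcross : ∀ A ∈ F, ∀ B ∈ G, t ≤ (A ∩ B).card) :
    F.card + G.card ≤
      max
        (((Hfam n k l).filter (fun A => t ≤ (A ∩ Vset n l').card)).card +
          ({Vset n l'} : Finset (Finset ℕ)).card)
        ((Finset.Icc (l' + 1) l).sup (fun a =>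
          ((Hfam n k l).filter (fun A => Vset n a ⊆ A)).card +
            ((Hfam n k l').filter (fun B => t ≤ (B ∩ Vset n a).card)).card)) := by
  have hn1 : 1 ≤ n := by omega
  have hlast : coverSum k (traceWeight n k l') l' + meetSum k t (traceWeight n k l) l' ≤
      ((Hfam n k l).filter (fun A => t ≤ (A ∩ Vset n l').card)).card +
        ({Vset n l'} : Finset (Finset ℕ)).card := by
    rw [meetSum_traceWeight hn1 (hll.trans hkl), Finset.card_singleton, add_comm]
    exact Nat.add_le_add_left (coverSum_traceWeight_self_le hn1 (hll.trans hkl)) _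
  refine (card_add_card_le_max hn hkl (hll.trans hkl) ht (htl.trans hll) htl hF hG hFne hGne
    hcross).trans (max_le ?_ (le_max_of_le_left hlast))
  rcases hll.eq_or_lt with rfl | hlt
  · exact le_max_of_le_left hlast
  · refine le_max_of_le_right ?_
    rw [meetSum_traceWeight hn1 hkl, coverSum_traceWeight hkl]
    exact Finset.le_sup (f := fun a => ((Hfam n k l).filter (fun A => Vset n a ⊆ A)).card +
      ((Hfam n k l').filter (fun B => t ≤ (B ∩ Vset n a).card)).card)
      (Finset.mem_Icc.2 ⟨hlt, le_rfl⟩)
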